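/- Let d ≥ 1 and let (p_x, φ_x)_{x=1}^N be a 2-design in dimension d, defining the ensemble E = {ρ_x = p_x |φ_x⟩⟨φ_x|}. Then for every POVM P = {Π_y}_{y=1}^M in dimension d, the mutual information satisfies I(E, P) ≤ log₂( 2d/(d+1) ). In particular the accessible information of any d-dimensional 2-design ensemble is at most log₂(2d/(d+1)) < 1 bit. -/

import Mathlib

open Matrix Finset
open scoped Kronecker BigOperators ComplexOrder

/-- The rank-one operator `|φ⟩⟨φ|` associated to a vector `φ : Fin d → ℂ`. -/
noncomputable def outerProd {d : ℕ} (φ : Fin d → ℂ) : Matrix (Fin d) (Fin d) ℂ :=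
  Matrix.vecMulVec φ (star φ)

/-- The swap operator `S` on `ℂ^d ⊗ ℂ^d`, determined by `S (u ⊗ v) = v ⊗ u`. -/
noncomputable def swapMatrix (d : ℕ) : Matrix (Fin d × Fin d) (Fin d × Fin d) ℂ :=
  Matrix.of fun p q => if p.1 = q.2 ∧ p.2 = q.1 then 1 else 0

/-- `(p, φ)` is a spherical quantum 2-design in dimension `d`: the `φ x` are unit
vectors, the weights `p x` are nonnegative and sum to one, and
`Σ_x p_x (|φ_x⟩⟨φ_x|)^{⊗2} = (I + S)/(d(d+1))`. -/
noncomputable def IsTwoDesign {d N : ℕ} (p : Fin N → ℝ) (φ : Fin N → Fin d → ℂ) : Prop :=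
  (∀ x, 0 ≤ p x) ∧ (∑ x, p x = 1) ∧ (∀ x, star (φ x) ⬝ᵥ φ x = 1) ∧
  (∑ x, (p x : ℂ) • (outerProd (φ x) ⊗ₖ outerProd (φ x))
      = (((d : ℂ) * ((d : ℂ) + 1))⁻¹) • (1 + swapMatrix d))

/-- The mutual information (in bits) of a finite joint probability distribution
`p : X → Y → ℝ`, with the convention `0·log₂ 0 = 0` (terms with `p x y = 0` vanish). -/
noncomputable def mutualInfo {X Y : Type*} [Fintype X] [Fintype Y] (p : X → Y → ℝ) : ℝ :=
  ∑ x, ∑ y, p x y * Real.logb 2 (p x y / ((∑ y', p x y') * (∑ x', p x' y)))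

/-- The trace of the swap operator against a Kronecker product `A ⊗ B` is `Tr (A B)`. -/
lemma trace_swapMatrix_mul_kronecker {d : ℕ} (A B : Matrix (Fin d) (Fin d) ℂ) :
    (swapMatrix d * (A ⊗ₖ B)).trace = (A * B).trace := by
  simp only [Matrix.trace, Matrix.diag_apply, Matrix.mul_apply, swapMatrix, Matrix.of_apply,
    Matrix.kroneckerMap_apply, Fintype.sum_prod_type, ite_and, ite_mul, one_mul, zero_mul]
  rw [Finset.sum_comm]
  simp

/-- A 2-design averages products of two expectation values as the Haar measure does. -/
lemma IsTwoDesign.sum_trace_mul_trace {d N : ℕ} {p : Fin N → ℝ} {φ : Fin N → Fin d → ℂ}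
    (h : IsTwoDesign p φ) (A B : Matrix (Fin d) (Fin d) ℂ) :
    ∑ x, (p x : ℂ) * ((outerProd (φ x) * A).trace * (outerProd (φ x) * B).trace)
      = ((d : ℂ) * ((d : ℂ) + 1))⁻¹ * (A.trace * B.trace + (A * B).trace) := by
  have h2 := congrArg (fun C => (C * (A ⊗ₖ B)).trace) h.2.2.2
  simpa only [Finset.sum_mul, Matrix.trace_sum, Matrix.smul_mul, Matrix.trace_smul,
    ← Matrix.mul_kronecker_mul, Matrix.trace_kronecker, Matrix.add_mul, Matrix.one_mul,
    Matrix.trace_add, trace_swapMatrix_mul_kronecker, smul_eq_mul] using h2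

/-- A 2-design averages expectation values as the Haar measure does. -/
lemma IsTwoDesign.sum_trace {d N : ℕ} (hd : 1 ≤ d) {p : Fin N → ℝ} {φ : Fin N → Fin d → ℂ}
    (h : IsTwoDesign p φ) (A : Matrix (Fin d) (Fin d) ℂ) :
    ∑ x, (p x : ℂ) * (outerProd (φ x) * A).trace = A.trace / d := by
  have h1 : ∀ x, (outerProd (φ x)).trace = 1 := fun x => by
    rw [outerProd, Matrix.trace_vecMulVec, dotProduct_comm, h.2.2.1 x]
  have h2 := h.sum_trace_mul_trace A 1
  have hd0 : (d : ℂ) ≠ 0 := by exact_mod_cast (by omega : d ≠ 0)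
  have hd1 : (d : ℂ) + 1 ≠ 0 := by exact_mod_cast d.succ_ne_zero
  simp only [mul_one, h1, Matrix.trace_one, Fintype.card_fin] at h2
  rw [h2]
  field_simp

lemma outerProd_mul_trace_nonneg {d : ℕ} (φ : Fin d → ℂ) {A : Matrix (Fin d) (Fin d) ℂ}
    (hA : A.PosSemidef) : 0 ≤ (outerProd φ * A).trace := by
  rw [outerProd, Matrix.vecMulVec_mul, Matrix.trace_vecMulVec, dotProduct_comm,
    ← Matrix.dotProduct_mulVec]
  exact hA.dotProduct_mulVec_nonneg φ

lemma Matrix.PosSemidef.trace_mul_self_le {n : Type*} [Fintype n]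
    {A : Matrix n n ℂ} (hA : A.PosSemidef) : (A * A).trace ≤ A.trace * A.trace := by
  simp only [Matrix.trace, Matrix.diag_apply, Matrix.mul_apply, Finset.sum_mul_sum]
  refine Finset.sum_le_sum fun i _ => Finset.sum_le_sum fun j _ => ?_
  have h := (hA.submatrix ![i, j]).det_nonneg
  rw [Matrix.det_fin_two] at h
  simpa using h

/-- If `∑ x, p x * r x y ^ 2 ≤ c * q y ^ 2` for the marginals `q`, then the mutual information of
the joint distribution `p x * r x y` is at most `log₂ c`. -/
lemma mutualInfo_le_logb {X Y : Type*} [Fintype X] [Fintype Y] {p : X → ℝ} {r : X → Y → ℝ} {c : ℝ}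
    (hc : 0 < c) (hp : ∀ x, 0 ≤ p x) (hp1 : ∑ x, p x = 1) (hr : ∀ x y, 0 ≤ r x y)
    (hr1 : ∀ x, ∑ y, r x y = 1)
    (h : ∀ y, ∑ x, p x * r x y ^ 2 ≤ c * (∑ x, p x * r x y) ^ 2) :
    mutualInfo (fun x y => p x * r x y) ≤ Real.logb 2 c := by
  have hm : ∀ x, ∑ y, p x * r x y = p x := fun x => by rw [← Finset.mul_sum, hr1, mul_one]
  simp only [mutualInfo, hm]
  set q : Y → ℝ := fun y => ∑ x, p x * r x y with hq
  have hq0 : ∀ y, 0 ≤ q y := fun y => Finset.sum_nonneg fun x _ => mul_nonneg (hp x) (hr x y)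
  have hl : 0 < Real.log 2 := Real.log_pos one_lt_two
  have hterm : ∀ x y, p x * r x y * Real.logb 2 (p x * r x y / (p x * q y)) ≤
      (p x * r x y * (Real.log c - 1) + p x * r x y ^ 2 / (c * q y)) / Real.log 2 := by
    intro x y
    rcases (mul_nonneg (hp x) (hr x y)).eq_or_lt with h0 | h0
    · rw [← h0, zero_mul, zero_mul, zero_add]
      exact div_nonneg (div_nonneg (mul_nonneg (hp x) (sq_nonneg _))
        (mul_nonneg hc.le (hq0 y))) hl.le
    · have hpx : 0 < p x := pos_of_mul_pos_left h0 (hr x y)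
      have hrx : 0 < r x y := pos_of_mul_pos_right h0 (hp x)
      have hqy : 0 < q y := h0.trans_le (Finset.single_le_sum (f := fun x => p x * r x y)
        (fun x _ => mul_nonneg (hp x) (hr x y)) (Finset.mem_univ x))
      rw [mul_div_mul_left _ _ hpx.ne', Real.logb, ← mul_div_assoc]
      gcongr
      have hlog := Real.log_le_sub_one_of_pos (show 0 < r x y / (c * q y) by positivity)
      rw [show r x y / (c * q y) = r x y / q y / c by field_simp,
        Real.log_div (by positivity) hc.ne'] at hlog
      calc p x * r x y * Real.log (r x y / q y)
          ≤ p x * r x y * (Real.log c - 1 + r x y / q y / c) := by gcongr; linarith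
        _ = _ := by field_simp
  have hcol : ∀ y, (∑ x, p x * r x y ^ 2) / (c * q y) ≤ q y := by
    intro y
    rcases (hq0 y).eq_or_lt with h0 | h0
    · simp [← h0]
    · rw [div_le_iff₀ (by positivity)]
      linarith [h y, show q y * (c * q y) = c * (∑ x, p x * r x y) ^ 2 by rw [hq]; ring]
  have htot : ∑ y, q y = 1 := by
    rw [hq, Finset.sum_comm]
    simp only [hm, hp1]
  calc ∑ x, ∑ y, p x * r x y * Real.logb 2 (p x * r x y / (p x * q y))
      ≤ ∑ x, ∑ y,
          (p x * r x y * (Real.log c - 1) + p x * r x y ^ 2 / (c * q y)) / Real.log 2 :=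
        Finset.sum_le_sum fun x _ => Finset.sum_le_sum fun y _ => hterm x y
    _ = ∑ y, (q y * (Real.log c - 1) + (∑ x, p x * r x y ^ 2) / (c * q y)) / Real.log 2 := by
        rw [Finset.sum_comm]
        simp only [hq, ← Finset.sum_div, Finset.sum_add_distrib, ← Finset.sum_mul]
    _ ≤ ∑ y, (q y * (Real.log c - 1) + q y) / Real.log 2 := by
        gcongr with y
        exact hcol y
    _ = Real.logb 2 c := by
        rw [← Finset.sum_div, Finset.sum_add_distrib, ← Finset.sum_mul, htot, Real.logb]
        ring

/-- Accessible information bound for 2-design ensembles: for the ensemble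
`E = {ρ_x = p_x|φ_x⟩⟨φ_x|}` arising from any 2-design and any POVM `{Π_y}`,
the mutual information satisfies `I(E,P) ≤ log₂(2d/(d+1)) < 1` bit. -/
theorem accessible_information_bound_two_design {d N : ℕ} (hd : 1 ≤ d)
    (p : Fin N → ℝ) (φ : Fin N → Fin d → ℂ) (hdesign : IsTwoDesign p φ)
    {M : ℕ} (Pt : Fin M → Matrix (Fin d) (Fin d) ℂ)
    (hPsd : ∀ y, (Pt y).PosSemidef) (hPsum : ∑ y, Pt y = 1) :
    mutualInfo (fun x y => (((p x : ℂ) • outerProd (φ x)) * Pt y).trace.re)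
      ≤ Real.logb 2 (2 * (d : ℝ) / ((d : ℝ) + 1)) ∧
    Real.logb 2 (2 * (d : ℝ) / ((d : ℝ) + 1)) < 1 := by
  have hd0 : (0 : ℝ) < d := by exact_mod_cast hd
  constructor
  · obtain ⟨hp, hp1, hφ, -⟩ := id hdesign
    have hreal : ∀ x y, (((outerProd (φ x) * Pt y).trace.re : ℝ) : ℂ)
        = (outerProd (φ x) * Pt y).trace := fun x y =>
      (Complex.eq_re_of_ofReal_le (r := 0)
        (by simpa using (outerProd_mul_trace_nonneg (φ x) (hPsd y)))).symm
    simp only [Matrix.smul_mul, Matrix.trace_smul, smul_eq_mul, Complex.re_ofReal_mul]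
    refine mutualInfo_le_logb (by positivity) hp hp1
      (fun x y => (Complex.nonneg_iff.mp (outerProd_mul_trace_nonneg (φ x) (hPsd y))).1) ?_ ?_
    · intro x
      rw [← Complex.re_sum, ← Matrix.trace_sum, ← Matrix.mul_sum, hPsum, Matrix.mul_one,
        outerProd, Matrix.trace_vecMulVec, dotProduct_comm, hφ x, Complex.one_re]
    · intro y
      have hsum := hdesign.sum_trace hd (Pt y)
      have hsq : ∑ x, (p x : ℂ) * (((outerProd (φ x) * Pt y).trace.re : ℝ) *
          ((outerProd (φ x) * Pt y).trace.re : ℝ)) = ((d : ℂ) * ((d : ℂ) + 1))⁻¹ *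
            ((Pt y).trace * (Pt y).trace + (Pt y * Pt y).trace) := by
        simpa only [hreal] using hdesign.sum_trace_mul_trace (Pt y) (Pt y)
      have hle := (hPsd y).trace_mul_self_le
      have htr : (Pt y).trace = ((d * ∑ x, p x * (outerProd (φ x) * Pt y).trace.re : ℝ) : ℂ) := by
        have hdc : (d : ℂ) ≠ 0 := by exact_mod_cast hd0.ne'
        push_cast
        simp only [hreal]
        rw [hsum]
        field_simp
      rw [htr] at hsq hle
      set q : ℝ := ∑ x, p x * (outerProd (φ x) * Pt y).trace.re
      have hsq' := congrArg Complex.re hsq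
      have hle' := (Complex.le_def.mp hle).1
      rw [← Complex.ofReal_mul, Complex.ofReal_re] at hle'
      rw [← Complex.ofReal_natCast, ← Complex.ofReal_one, ← Complex.ofReal_add,
        ← Complex.ofReal_mul, ← Complex.ofReal_inv, Complex.re_ofReal_mul, Complex.add_re,
        ← Complex.ofReal_mul, Complex.ofReal_re, Complex.re_sum] at hsq'
      simp only [Complex.re_ofReal_mul, Complex.ofReal_re] at hsq'
      simp only [pow_two]
      rw [hsq', inv_mul_le_iff₀ (by positivity)]
      refine (add_le_add_right hle' _).trans (le_of_eq ?_)
      field_simp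
      ring
  · rw [Real.logb_lt_iff_lt_rpow one_lt_two (by positivity), Real.rpow_one,
      div_lt_iff₀ (by positivity)]
    linarith
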